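/- The two invariants f ↦ (f,f)_4 and f ↦ ((f,f)_2,f)_4, homogeneous of degrees 2 and 3 in the coefficients, form a homogeneous system of parameters of the algebra O(V_4)^{SL_2} of polynomial invariants of the binary quartic. -/

import Mathlib

open MvPolynomial

/-- The `k`-th transvectant of two binary forms `f` of degree `n` and `g` of degree `m`
(coefficients in a commutative `ℂ`-algebra `R`). -/
noncomputable def transv {R : Type} [CommRing R] [Algebra ℂ R] (n m k : ℕ)
    (f g : MvPolynomial (Fin 2) R) : MvPolynomial (Fin 2) R :=
  ((((n - k).factorial * (m - k).factorial : ℕ) : ℂ) / ((n.factorial * m.factorial : ℕ) : ℂ)) •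
    ∑ i ∈ Finset.range (k + 1),
      ((-1 : ℂ) ^ i * (k.choose i : ℂ)) •
        ((fun p => pderiv (0 : Fin 2) p)^[k - i] ((fun p => pderiv (1 : Fin 2) p)^[i] f) *
         (fun p => pderiv (0 : Fin 2) p)^[i] ((fun p => pderiv (1 : Fin 2) p)^[k - i] g))

/-- The binary form of degree `n` with coefficient vector `a`,
`f = ∑ binom(n,i) aᵢ x^(n-i) y^i`. -/
noncomputable def formOf (n : ℕ) (a : Fin (n + 1) → ℂ) : MvPolynomial (Fin 2) ℂ :=
  ∑ i : Fin (n + 1), C ((n.choose (i : ℕ) : ℂ) * a i) * X 0 ^ (n - (i : ℕ)) * X 1 ^ (i : ℕ)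

/-- The action of `SL₂(ℂ)` on binary forms: `(g · f)(v) = f (g⁻¹ v)`. -/
noncomputable def sl2Act (g : Matrix.SpecialLinearGroup (Fin 2) ℂ)
    (f : MvPolynomial (Fin 2) ℂ) : MvPolynomial (Fin 2) ℂ :=
  aeval (fun i => ∑ j,
    (((g⁻¹ : Matrix.SpecialLinearGroup (Fin 2) ℂ) : Matrix (Fin 2) (Fin 2) ℂ) i j) • X j) f

/-- The coefficient vector of a binary form of degree `n`:
`aᵢ` is the coefficient of `x^(n-i) y^i` divided by `binom(n,i)`. -/
noncomputable def coeffOf (n : ℕ) (f : MvPolynomial (Fin 2) ℂ) (i : Fin (n + 1)) : ℂ :=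
  coeff (Finsupp.single 0 (n - (i : ℕ)) + Finsupp.single 1 (i : ℕ)) f / (n.choose (i : ℕ) : ℂ)

/-- The graded algebra `O(V_n)^{SL₂}` of polynomial invariants of the binary form of
degree `n`: polynomials `P` in the coefficients `a₀, …, aₙ` such that `P` takes the same
value at the coefficients of `g · f` as at the coefficients of `f`, for every
`g ∈ SL₂(ℂ)` and every `f ∈ Vₙ`. -/
noncomputable def invariantAlgebra (n : ℕ) : Subalgebra ℂ (MvPolynomial (Fin (n + 1)) ℂ) :=
  ⨅ p : Matrix.SpecialLinearGroup (Fin 2) ℂ × (Fin (n + 1) → ℂ),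
    AlgHom.equalizer
      (aeval (coeffOf n (sl2Act p.1 (formOf n p.2))) : MvPolynomial (Fin (n + 1)) ℂ →ₐ[ℂ] ℂ)
      (aeval p.2)

/-- `v` is a homogeneous system of parameters of `O(V_n)^{SL₂}`: a family of homogeneous
invariants, algebraically independent over `ℂ`, such that `O(V_n)^{SL₂}` is a finitely
generated module over the `ℂ`-subalgebra they generate. -/
def IsHSOP (n : ℕ) {ι : Type} [Fintype ι] (v : ι → MvPolynomial (Fin (n + 1)) ℂ) : Prop :=
  (∀ i, v i ∈ invariantAlgebra n) ∧
  (∀ i, ∃ d : ℕ, (v i).IsHomogeneous d) ∧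
  AlgebraicIndependent ℂ v ∧
  ∃ F : Finset (MvPolynomial (Fin (n + 1)) ℂ),
    (F : Set (MvPolynomial (Fin (n + 1)) ℂ)) ⊆
      (invariantAlgebra n : Set (MvPolynomial (Fin (n + 1)) ℂ)) ∧
    ∀ x ∈ invariantAlgebra n,
      x ∈ Submodule.span (Algebra.adjoin ℂ (Set.range v))
        (F : Set (MvPolynomial (Fin (n + 1)) ℂ))

/-- The generic binary form of degree `n`, with coefficients the variables
`a₀, …, aₙ` of the polynomial ring `ℂ[a₀, …, aₙ]`. -/
noncomputable def genForm (n : ℕ) : MvPolynomial (Fin 2) (MvPolynomial (Fin (n + 1)) ℂ) :=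
  ∑ i : Fin (n + 1),
    MvPolynomial.C (MvPolynomial.C (n.choose (i : ℕ) : ℂ) * MvPolynomial.X i) *
      MvPolynomial.X (0 : Fin 2) ^ (n - (i : ℕ)) * MvPolynomial.X (1 : Fin 2) ^ (i : ℕ)

/-- The invariant `f ↦ (f,f)₄` of the binary quartic, as a polynomial in the
coefficients `a₀, …, a₄`. -/
noncomputable def quarticI2 : MvPolynomial (Fin 5) ℂ :=
  coeff 0 (transv 4 4 4 (genForm 4) (genForm 4))

/-- The invariant `f ↦ ((f,f)₂,f)₄` of the binary quartic, as a polynomial in the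
coefficients `a₀, …, a₄`. -/
noncomputable def quarticI3 : MvPolynomial (Fin 5) ℂ :=
  coeff 0 (transv 4 4 4 (transv 4 4 2 (genForm 4) (genForm 4)) (genForm 4))

/-- The binary form `∑ bᵢ x^(n-i) y^i` of degree `n`, without binomial factors. -/
noncomputable def plainForm {R : Type} [CommRing R] (n : ℕ) (b : ℕ → R) :
    MvPolynomial (Fin 2) R :=
  ∑ i ∈ Finset.range (n + 1), C (b i) * X 0 ^ (n - i) * X 1 ^ i

lemma pderiv_zero_plainForm {R : Type} [CommRing R] (n : ℕ) (b : ℕ → R) :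
    pderiv 0 (plainForm (n + 1) b) = plainForm n fun i => ((n + 1 - i : ℕ) : R) * b i := by
  rw [plainForm, Finset.sum_range_succ, map_add, map_sum, plainForm]
  refine (congrArg₂ _ (Finset.sum_congr rfl fun i hi => ?_) ?_).trans (add_zero _)
  rotate_left
  · simp [Derivation.leibniz, Derivation.leibniz_pow, pderiv_X]
  · have : n + 1 - i - 1 = n - i := by omega
    simp [Derivation.leibniz, Derivation.leibniz_pow, pderiv_X, this]
    ring

lemma pderiv_one_plainForm {R : Type} [CommRing R] (n : ℕ) (b : ℕ → R) :
    pderiv 1 (plainForm (n + 1) b) = plainForm n fun i => ((i + 1 : ℕ) : R) * b (i + 1) := by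
  rw [plainForm, Finset.sum_range_succ', map_add, map_sum, plainForm]
  refine (congrArg₂ _ (Finset.sum_congr rfl fun i hi => ?_) ?_).trans (add_zero _)
  rotate_left
  · simp [Derivation.leibniz, Derivation.leibniz_pow, pderiv_X]
  · simp [Derivation.leibniz, Derivation.leibniz_pow, pderiv_X]
    ring

/-- The coefficients of the second transvectant of a binary quartic with itself. -/
noncomputable def hessianCoeff {R : Type} [CommRing R] [Algebra ℂ R] (b : ℕ → R) : ℕ → R
  | 0 => algebraMap ℂ R (1 / 24) * (8 * b 0 * b 2 - 3 * b 1 ^ 2)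
  | 1 => algebraMap ℂ R (1 / 24) * (24 * b 0 * b 3 - 4 * b 1 * b 2)
  | 2 => algebraMap ℂ R (1 / 24) * (48 * b 0 * b 4 + 6 * b 1 * b 3 - 4 * b 2 ^ 2)
  | 3 => algebraMap ℂ R (1 / 24) * (24 * b 1 * b 4 - 4 * b 2 * b 3)
  | 4 => algebraMap ℂ R (1 / 24) * (8 * b 2 * b 4 - 3 * b 3 ^ 2)
  | _ => 0

lemma smul_eq_C_algebraMap_mul {R : Type} [CommRing R] [Algebra ℂ R] (c : ℂ)
    (p : MvPolynomial (Fin 2) R) : c • p = C (algebraMap ℂ R c) * p := by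
  rw [Algebra.smul_def, MvPolynomial.algebraMap_apply]

lemma transv_plainForm_two {R : Type} [CommRing R] [Algebra ℂ R] (b : ℕ → R) :
    transv 4 4 2 (plainForm 4 b) (plainForm 4 b) = plainForm 4 (hessianCoeff b) := by
  have h : (C (algebraMap ℂ R (1 / 24)) : MvPolynomial (Fin 2) R) =
      C (algebraMap ℂ R (1 / 144)) * 6 := by
    rw [← map_ofNat C 6, ← map_mul, ← map_ofNat (algebraMap ℂ R) 6, ← map_mul]
    norm_num
  have h2 : (2 * 2 / (24 * 24) : ℂ) = 1 / 144 := by norm_num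
  simp only [transv, Finset.sum_range_succ, Finset.sum_range_zero, Function.iterate_succ,
    Function.iterate_zero, Function.comp, id, Nat.sub_self, Nat.sub_zero, Nat.reduceSub,
    pderiv_zero_plainForm, pderiv_one_plainForm, smul_eq_C_algebraMap_mul]
  simp only [plainForm, Finset.sum_range_succ, Finset.sum_range_zero, hessianCoeff, map_mul, h,
    Nat.factorial, Nat.choose]
  have hC2 : (C 2 : MvPolynomial (Fin 2) R) = 2 := map_ofNat C 2
  have hC3 : (C 3 : MvPolynomial (Fin 2) R) = 3 := map_ofNat C 3
  have hC4 : (C 4 : MvPolynomial (Fin 2) R) = 4 := map_ofNat C 4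
  have hC6 : (C 6 : MvPolynomial (Fin 2) R) = 6 := map_ofNat C 6
  have hC8 : (C 8 : MvPolynomial (Fin 2) R) = 8 := map_ofNat C 8
  have hC24 : (C 24 : MvPolynomial (Fin 2) R) = 24 := map_ofNat C 24
  have hC48 : (C 48 : MvPolynomial (Fin 2) R) = 48 := map_ofNat C 48
  have hA2 : algebraMap ℂ R 2 = 2 := map_ofNat (algebraMap ℂ R) 2
  norm_num [h2, hA2, hC2, hC3, hC4, hC6, hC8, hC24, hC48]
  ring

lemma transv_plainForm_four {R : Type} [CommRing R] [Algebra ℂ R] (b c : ℕ → R) :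
    transv 4 4 4 (plainForm 4 b) (plainForm 4 c) =
      C (b 0 * c 4 + b 4 * c 0 - algebraMap ℂ R (1 / 4) * (b 1 * c 3 + b 3 * c 1) +
        algebraMap ℂ R (1 / 6) * (b 2 * c 2)) := by
  have hk (n : ℕ) : C (algebraMap ℂ R (1 / 576)) * (n : MvPolynomial (Fin 2) R) =
      C (algebraMap ℂ R (n / 576)) := by
    rw [← map_natCast C n, ← map_mul, ← map_natCast (algebraMap ℂ R) n, ← map_mul]
    congr 2
    ring
  have h1 := hk 576
  have h4 := hk 144
  have h6 := hk 96
  norm_num at h1 h4 h6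
  simp only [transv, Finset.sum_range_succ, Finset.sum_range_zero, Function.iterate_succ,
    Function.iterate_zero, Function.comp, id, Nat.sub_self, Nat.sub_zero, Nat.reduceSub,
    pderiv_zero_plainForm, pderiv_one_plainForm, smul_eq_C_algebraMap_mul]
  simp only [plainForm, Finset.sum_range_succ, Finset.sum_range_zero,
    Nat.factorial, Nat.choose]
  have hC2 : (C 2 : MvPolynomial (Fin 2) R) = 2 := map_ofNat C 2
  have hC3 : (C 3 : MvPolynomial (Fin 2) R) = 3 := map_ofNat C 3
  have hC4 : (C 4 : MvPolynomial (Fin 2) R) = 4 := map_ofNat C 4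
  have hC6 : (C 6 : MvPolynomial (Fin 2) R) = 6 := map_ofNat C 6
  have hA4 : algebraMap ℂ R 4 = 4 := map_ofNat (algebraMap ℂ R) 4
  have hA6 : algebraMap ℂ R 6 = 6 := map_ofNat (algebraMap ℂ R) 6
  norm_num [hA4, hA6, hC2, hC3, hC4, hC6]
  linear_combination (C (b 0) * C (c 4) + C (b 4) * C (c 0)) * h1 -
    (C (b 1) * C (c 3) + C (b 3) * C (c 1)) * h4 + C (b 2) * C (c 2) * h6

lemma genForm_four : genForm 4 = plainForm 4 fun i =>
    if h : i < 5 then C (Nat.choose 4 i : ℂ) * X (⟨i, h⟩ : Fin 5) else 0 := by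
  rw [plainForm, Finset.sum_range]
  simp [genForm]

lemma quarticI2_eq : quarticI2 = C 2 * X 0 * X 4 - C 8 * X 1 * X 3 + C 6 * X 2 ^ 2 := by
  have e2 : (⟨2, by decide⟩ : Fin 5) = 2 := rfl
  have e3 : (⟨3, by decide⟩ : Fin 5) = 3 := rfl
  have e4 : (⟨4, by decide⟩ : Fin 5) = 4 := rfl
  rw [quarticI2, genForm_four, transv_plainForm_four, coeff_zero_C, MvPolynomial.algebraMap_eq]
  refine MvPolynomial.funext fun a => ?_
  norm_num [e2, e3, e4, Nat.choose]
  ring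

lemma quarticI3_eq : quarticI3 = C 6 * X 0 * X 2 * X 4 + C 12 * X 1 * X 2 * X 3 -
    C 6 * X 2 ^ 3 - C 6 * X 0 * X 3 ^ 2 - C 6 * X 1 ^ 2 * X 4 := by
  have e2 : (⟨2, by decide⟩ : Fin 5) = 2 := rfl
  have e3 : (⟨3, by decide⟩ : Fin 5) = 3 := rfl
  have e4 : (⟨4, by decide⟩ : Fin 5) = 4 := rfl
  rw [quarticI3, genForm_four, transv_plainForm_two, transv_plainForm_four, coeff_zero_C,
    MvPolynomial.algebraMap_eq]
  refine MvPolynomial.funext fun a => ?_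
  norm_num [e2, e3, e4, Nat.choose, hessianCoeff]
  ring

lemma quarticI2_isHomogeneous : quarticI2.IsHomogeneous 2 := by
  have hX (i : Fin 5) := isHomogeneous_X ℂ i
  have hC (c : ℂ) := isHomogeneous_C (Fin 5) c
  rw [quarticI2_eq]
  exact ((((hC _).mul (hX _)).mul (hX _)).sub (((hC _).mul (hX _)).mul (hX _))).add
    ((hC _).mul ((hX _).pow 2))

lemma quarticI3_isHomogeneous : quarticI3.IsHomogeneous 3 := by
  have hX (i : Fin 5) := isHomogeneous_X ℂ i
  have hC (c : ℂ) := isHomogeneous_C (Fin 5) c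
  rw [quarticI3_eq]
  exact (((((((hC _).mul (hX _)).mul (hX _)).mul (hX _)).add
    ((((hC _).mul (hX _)).mul (hX _)).mul (hX _))).sub ((hC _).mul ((hX _).pow 3))).sub
    (((hC _).mul (hX _)).mul ((hX _).pow 2))).sub (((hC _).mul ((hX _).pow 2)).mul (hX _))

/-- Coefficients of `f (αx + βy, γx + δy)`, where `f` is the quartic with coefficients `a`. -/
def quarticSubst (α β γ δ : ℂ) (a : Fin 5 → ℂ) : Fin 5 → ℂ :=
  ![a 0 * α ^ 4 + 4 * a 1 * α ^ 3 * γ + 6 * a 2 * α ^ 2 * γ ^ 2 + 4 * a 3 * α * γ ^ 3 +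
      a 4 * γ ^ 4,
    a 0 * α ^ 3 * β + a 1 * (α ^ 3 * δ + 3 * α ^ 2 * β * γ) +
      3 * a 2 * (α ^ 2 * γ * δ + α * β * γ ^ 2) + a 3 * (3 * α * γ ^ 2 * δ + β * γ ^ 3) +
      a 4 * γ ^ 3 * δ,
    a 0 * α ^ 2 * β ^ 2 + 2 * a 1 * (α ^ 2 * β * δ + α * β ^ 2 * γ) +
      a 2 * (α ^ 2 * δ ^ 2 + 4 * α * β * γ * δ + β ^ 2 * γ ^ 2) +
      2 * a 3 * (α * γ * δ ^ 2 + β * γ ^ 2 * δ) + a 4 * γ ^ 2 * δ ^ 2,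
    a 0 * α * β ^ 3 + a 1 * (3 * α * β ^ 2 * δ + β ^ 3 * γ) +
      3 * a 2 * (α * β * δ ^ 2 + β ^ 2 * γ * δ) + a 3 * (α * δ ^ 3 + 3 * β * γ * δ ^ 2) +
      a 4 * γ * δ ^ 3,
    a 0 * β ^ 4 + 4 * a 1 * β ^ 3 * δ + 6 * a 2 * β ^ 2 * δ ^ 2 + 4 * a 3 * β * δ ^ 3 +
      a 4 * δ ^ 4]

lemma coeffOf_formOf (n : ℕ) (a : Fin (n + 1) → ℂ) : coeffOf n (formOf n a) = a := by
  funext i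
  have key : ∀ j : Fin (n + 1),
      (C ((n.choose (j : ℕ) : ℂ) * a j) * X 0 ^ (n - (j : ℕ)) * X 1 ^ (j : ℕ) :
        MvPolynomial (Fin 2) ℂ) =
      monomial (Finsupp.single 0 (n - (j : ℕ)) + Finsupp.single 1 (j : ℕ))
        ((n.choose (j : ℕ) : ℂ) * a j) := by
    intro j
    rw [X_pow_eq_monomial, X_pow_eq_monomial, C_mul_monomial, monomial_mul]
    simp
  have inj : ∀ j : Fin (n + 1),
      ((Finsupp.single 0 (n - (j : ℕ)) + Finsupp.single 1 (j : ℕ) : Fin 2 →₀ ℕ) =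
        Finsupp.single 0 (n - (i : ℕ)) + Finsupp.single 1 (i : ℕ)) ↔ j = i := by
    refine fun j => ⟨fun h => Fin.ext ?_, fun h => by rw [h]⟩
    simpa using DFunLike.congr_fun h 1
  have hc : (n.choose (i : ℕ) : ℂ) ≠ 0 :=
    Nat.cast_ne_zero.2 (Nat.choose_pos (Nat.lt_succ_iff.1 i.2)).ne'
  rw [coeffOf, formOf, Finset.sum_congr rfl fun j _ => key j, coeff_sum]
  simp only [coeff_monomial, inj]
  simp [hc]

lemma sl2Act_formOf_four (g : Matrix.SpecialLinearGroup (Fin 2) ℂ) (a : Fin 5 → ℂ) :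
    sl2Act g (formOf 4 a) =
      formOf 4 (quarticSubst (g⁻¹ 0 0) (g⁻¹ 0 1) (g⁻¹ 1 0) (g⁻¹ 1 1) a) := by
  generalize hM : g⁻¹ = M
  have h2 : (C 2 : MvPolynomial (Fin 2) ℂ) = 2 := map_ofNat C 2
  have h3 : (C 3 : MvPolynomial (Fin 2) ℂ) = 3 := map_ofNat C 3
  have h4 : (C 4 : MvPolynomial (Fin 2) ℂ) = 4 := map_ofNat C 4
  have h6 : (C 6 : MvPolynomial (Fin 2) ℂ) = 6 := map_ofNat C 6
  simp [sl2Act, hM, formOf, quarticSubst, Fin.sum_univ_succ, Nat.choose, smul_eq_C_mul,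
    h2, h3, h4, h6]
  ring

lemma mem_invariantAlgebra_four_iff {P : MvPolynomial (Fin 5) ℂ} :
    P ∈ invariantAlgebra 4 ↔ ∀ α β γ δ : ℂ, α * δ - β * γ = 1 → ∀ a : Fin 5 → ℂ,
      eval (quarticSubst α β γ δ a) P = eval a P := by
  have hmem : P ∈ invariantAlgebra 4 ↔ ∀ (g : Matrix.SpecialLinearGroup (Fin 2) ℂ)
      (a : Fin 5 → ℂ), eval (quarticSubst (g 0 0) (g 0 1) (g 1 0) (g 1 1) a) P = eval a P := by
    rw [invariantAlgebra, Algebra.mem_iInf, Prod.forall]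
    refine Iff.trans ?_ inv_surjective.forall.symm
    refine forall₂_congr fun g a => ?_
    rw [AlgHom.mem_equalizer, sl2Act_formOf_four, coeffOf_formOf]
    rfl
  rw [hmem]
  refine ⟨fun h α β γ δ hd a => ?_, fun h g a => h _ _ _ _ ?_ a⟩
  · exact h ⟨!![α, β; γ, δ], by rw [Matrix.det_fin_two_of, hd]⟩ a
  · rw [← Matrix.det_fin_two]
    exact g.2

/-- The invariant `a₀a₄ - 4a₁a₃ + 3a₂²` of the binary quartic. -/
def quarticI (a : Fin 5 → ℂ) : ℂ := a 0 * a 4 - 4 * a 1 * a 3 + 3 * a 2 ^ 2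

/-- The catalecticant of the binary quartic. -/
def quarticJ (a : Fin 5 → ℂ) : ℂ :=
  a 0 * a 2 * a 4 + 2 * a 1 * a 2 * a 3 - a 2 ^ 3 - a 0 * a 3 ^ 2 - a 1 ^ 2 * a 4

lemma quarticI_subst (α β γ δ : ℂ) (a : Fin 5 → ℂ) :
    quarticI (quarticSubst α β γ δ a) = (α * δ - β * γ) ^ 4 * quarticI a := by
  simp [quarticI, quarticSubst]
  ring

lemma quarticJ_subst (α β γ δ : ℂ) (a : Fin 5 → ℂ) :
    quarticJ (quarticSubst α β γ δ a) = (α * δ - β * γ) ^ 6 * quarticJ a := by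
  simp [quarticJ, quarticSubst]
  ring

lemma eval_quarticI2 (a : Fin 5 → ℂ) : eval a quarticI2 = 2 * quarticI a := by
  simp [quarticI2_eq, quarticI]
  ring

lemma eval_quarticI3 (a : Fin 5 → ℂ) : eval a quarticI3 = 6 * quarticJ a := by
  simp [quarticI3_eq, quarticJ]
  ring

lemma quarticI2_mem : quarticI2 ∈ invariantAlgebra 4 := by
  rw [mem_invariantAlgebra_four_iff]
  intro α β γ δ h a
  rw [eval_quarticI2, eval_quarticI2, quarticI_subst, h, one_pow, one_mul]

lemma quarticI3_mem : quarticI3 ∈ invariantAlgebra 4 := by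
  rw [mem_invariantAlgebra_four_iff]
  intro α β γ δ h a
  rw [eval_quarticI3, eval_quarticI3, quarticJ_subst, h, one_pow, one_mul]

/-- Every binary quartic has a linear factor. -/
lemma exists_quarticSubst_apply_zero (a : Fin 5 → ℂ) :
    ∃ α β γ δ : ℂ, α * δ - β * γ = 1 ∧ quarticSubst α β γ δ a 0 = 0 := by
  by_cases h : a 0 = 0
  · exact ⟨1, 0, 0, 1, by simp, by simp [quarticSubst, h]⟩
  · let p : Polynomial ℂ := .C (a 0) * .X ^ 4 + .C (4 * a 1) * .X ^ 3 + .C (6 * a 2) * .X ^ 2 +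
      .C (4 * a 3) * .X + .C (a 4)
    have hp : p.degree = 4 := by
      simp only [p]
      compute_degree!
    obtain ⟨r, hr⟩ := IsAlgClosed.exists_root p (by rw [hp]; decide)
    refine ⟨r, -1, 1, 0, by ring, ?_⟩
    simp only [Polynomial.IsRoot, p, Polynomial.eval_add, Polynomial.eval_mul, Polynomial.eval_C,
      Polynomial.eval_pow, Polynomial.eval_X] at hr
    simp only [quarticSubst, Matrix.cons_val_zero]
    linear_combination hr

/-- A quartic with a simple linear factor can be moved to `4 x³y + 4 s x y³ + t y⁴`. -/
lemma exists_quarticSubst_eq_section {a : Fin 5 → ℂ} (h0 : a 0 = 0) (h1 : a 1 ≠ 0) :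
    ∃ α β γ δ : ℂ, α * δ - β * γ = 1 ∧
      ∃ s t : ℂ, quarticSubst α β γ δ a = ![0, 1, 0, s, t] := by
  obtain ⟨α, hα⟩ := IsAlgClosed.exists_pow_nat_eq (a 1)⁻¹ two_pos
  have hα0 : α ≠ 0 := by
    rintro rfl
    exact inv_ne_zero h1 (by rw [← hα]; simp)
  have hα1 : a 1 * α ^ 2 = 1 := by rw [hα, mul_inv_cancel₀ h1]
  refine ⟨α, -a 2 / (2 * a 1 * α), 0, α⁻¹, by field_simp; ring,
    quarticSubst α (-a 2 / (2 * a 1 * α)) 0 α⁻¹ a 3,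
    quarticSubst α (-a 2 / (2 * a 1 * α)) 0 α⁻¹ a 4, ?_⟩
  ext i
  fin_cases i
  · simp [quarticSubst, h0]
  · simp [quarticSubst, h0]
    rw [← hα1]
    field_simp
  · simp [quarticSubst, h0]
    field_simp
    ring
  · rfl
  · rfl

/-- A quartic with a double linear factor has vanishing discriminant. -/
lemma quartic_disc_eq_zero {a : Fin 5 → ℂ} (h0 : a 0 = 0) (h1 : a 1 = 0) :
    quarticI a ^ 3 - 27 * quarticJ a ^ 2 = 0 := by
  simp only [quarticI, quarticJ, h0, h1]
  ring

lemma eval_eq_zero_of_section {P : MvPolynomial (Fin 5) ℂ} (hP : P ∈ invariantAlgebra 4)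
    (hs : ∀ s t : ℂ, eval ![0, 1, 0, s, t] P = 0) {a : Fin 5 → ℂ}
    (ha : quarticI a ^ 3 - 27 * quarticJ a ^ 2 ≠ 0) : eval a P = 0 := by
  rw [mem_invariantAlgebra_four_iff] at hP
  obtain ⟨α, β, γ, δ, hd, h0⟩ := exists_quarticSubst_apply_zero a
  rw [← hP α β γ δ hd a]
  have hb : quarticSubst α β γ δ a 1 ≠ 0 := fun h1 => ha <| by
    simpa [quarticI_subst, quarticJ_subst, hd] using quartic_disc_eq_zero h0 h1
  obtain ⟨α', β', γ', δ', hd', s, t, hst⟩ := exists_quarticSubst_eq_section h0 hb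
  rw [← hP α' β' γ' δ' hd', hst, hs]

/-- An invariant of the binary quartic is determined by its restriction to the quartics
`4 x³y + 4 s x y³ + t y⁴`. -/
lemma eq_zero_of_section {P : MvPolynomial (Fin 5) ℂ} (hP : P ∈ invariantAlgebra 4)
    (hs : ∀ s t : ℂ, eval ![0, 1, 0, s, t] P = 0) : P = 0 := by
  let D : MvPolynomial (Fin 5) ℂ := (C (1 / 2) * quarticI2) ^ 3 - 27 * (C (1 / 6) * quarticI3) ^ 2
  have hD (a : Fin 5 → ℂ) : eval a D = quarticI a ^ 3 - 27 * quarticJ a ^ 2 := by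
    simp [D, eval_quarticI2, eval_quarticI3]
  have hD0 : D ≠ 0 := fun h => by
    have := hD ![0, 1, 0, 1, 0]
    simp [h, quarticI, quarticJ] at this
    norm_num at this
  refine (mul_eq_zero.1 (?_ : D * P = 0)).resolve_left hD0
  refine MvPolynomial.funext fun a => ?_
  rw [map_mul, map_zero, hD]
  by_cases ha : quarticI a ^ 3 - 27 * quarticJ a ^ 2 = 0
  · rw [ha, zero_mul]
  · rw [eval_eq_zero_of_section hP hs ha, mul_zero]

lemma eval_section_aeval (s t : ℂ) (Q : MvPolynomial (Fin 2) ℂ) :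
    eval ![0, 1, 0, s, t] (aeval ![quarticI2, quarticI3] Q) = eval ![-8 * s, -6 * t] Q := by
  have h : (aeval ![0, 1, 0, s, t] : MvPolynomial (Fin 5) ℂ →ₐ[ℂ] ℂ).comp
      (aeval ![quarticI2, quarticI3]) = aeval ![-8 * s, -6 * t] := by
    ext i
    fin_cases i
    · simp [eval_quarticI2, quarticI]
      ring
    · simp [eval_quarticI3, quarticJ]
  exact DFunLike.congr_fun h Q

lemma algebraicIndependent_quarticI2_quarticI3 :
    AlgebraicIndependent ℂ ![quarticI2, quarticI3] := by
  rw [algebraicIndependent_iff]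
  refine fun Q hQ => MvPolynomial.funext fun x => ?_
  have := eval_section_aeval (-x 0 / 8) (-x 1 / 6) Q
  rw [hQ, map_zero] at this
  rw [map_zero, this]
  congr 2
  ext i
  fin_cases i <;> simp <;> ring

lemma aeval_mem_invariantAlgebra (Q : MvPolynomial (Fin 2) ℂ) :
    aeval ![quarticI2, quarticI3] Q ∈ invariantAlgebra 4 := by
  have hle : Algebra.adjoin ℂ (Set.range ![quarticI2, quarticI3]) ≤ invariantAlgebra 4 := by
    refine Algebra.adjoin_le ?_
    rintro _ ⟨i, rfl⟩
    fin_cases i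
    exacts [quarticI2_mem, quarticI3_mem]
  rw [Algebra.adjoin_range_eq_range_aeval] at hle
  exact hle ⟨Q, rfl⟩

/-- The invariants of the binary quartic are the polynomials in `quarticI2` and `quarticI3`. -/
lemma invariantAlgebra_four_le :
    invariantAlgebra 4 ≤ Algebra.adjoin ℂ (Set.range ![quarticI2, quarticI3]) := by
  intro P hP
  let Q : MvPolynomial (Fin 2) ℂ := aeval ![0, 1, 0, C (-1 / 8) * X 0, C (-1 / 6) * X 1] P
  have hQ (s t : ℂ) : eval ![-8 * s, -6 * t] Q = eval ![0, 1, 0, s, t] P := by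
    have h : (aeval ![-8 * s, -6 * t] : MvPolynomial (Fin 2) ℂ →ₐ[ℂ] ℂ).comp
        (aeval ![0, 1, 0, C (-1 / 8) * X 0, C (-1 / 6) * X 1]) = aeval ![0, 1, 0, s, t] := by
      ext i
      fin_cases i <;> simp <;> ring
    exact DFunLike.congr_fun h P
  rw [Algebra.adjoin_range_eq_range_aeval]
  refine ⟨Q, (sub_eq_zero.1 <| eq_zero_of_section
    (sub_mem hP (aeval_mem_invariantAlgebra Q)) fun s t => ?_).symm⟩
  rw [map_sub, eval_section_aeval, hQ, sub_self]

/-- The two invariants `f ↦ (f,f)₄` and `f ↦ ((f,f)₂,f)₄`, homogeneous of degrees 2 and 3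
in the coefficients, form a homogeneous system of parameters of the algebra
`O(V₄)^{SL₂}` of polynomial invariants of the binary quartic. -/
theorem quartic_hsop :
    quarticI2.IsHomogeneous 2 ∧ quarticI3.IsHomogeneous 3 ∧
    IsHSOP 4 ![quarticI2, quarticI3] := by
  refine ⟨quarticI2_isHomogeneous, quarticI3_isHomogeneous, ?_, ?_,
    algebraicIndependent_quarticI2_quarticI3, {1}, ?_, fun P hP => ?_⟩
  · rw [Fin.forall_fin_two]
    exact ⟨quarticI2_mem, quarticI3_mem⟩
  · rw [Fin.forall_fin_two]
    exact ⟨⟨2, quarticI2_isHomogeneous⟩, ⟨3, quarticI3_isHomogeneous⟩⟩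
  · simp [one_mem]
  · rw [Finset.coe_singleton, Submodule.mem_span_singleton]
    exact ⟨⟨P, invariantAlgebra_four_le hP⟩, mul_one P⟩
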